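/- Zero count for sequentially-ordered discrete Sobolev norms: let 1 < p < ∞ and let the discrete Sobolev norm ‖f‖ᵖ = ∫_Δ |f|ᵖ dμ + Σ_{j,k: A_{j,k}>0} A_{j,k}|f^{(k)}(c_j)|ᵖ be sequentially ordered with c_j ∉ int(Δ) for all j. Then the n-th minimal monic polynomial P_n has at least n − d* changes of sign in the interior of Δ, where d* is the number of pairs (j,k) with A_{j,k} > 0. -/

import Mathlib

open Polynomial MeasureTheory

/-- The support of a Borel measure on `ℝ`. -/
def measSupport (μ : Measure ℝ) : Set ℝ :=
  {x : ℝ | ∀ U : Set ℝ, IsOpen U → x ∈ U → μ U ≠ 0}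

/-- `P` changes sign at `ξ`: `P` takes values of both signs in every neighborhood
of `ξ`. -/
def SignChangeAt (P : Polynomial ℝ) (ξ : ℝ) : Prop :=
  ∀ ε > (0 : ℝ), (∃ x, |x - ξ| < ε ∧ P.eval x < 0) ∧ (∃ y, |y - ξ| < ε ∧ 0 < P.eval y)


/-- Points strictly between two points of a convex subset of `ℝ` are interior points. -/
lemma mem_interior_of_lt_of_lt {K : Set ℝ} (hK : Convex ℝ K) {x y z : ℝ}
    (hx : x ∈ K) (hy : y ∈ K) (hxz : x < z) (hzy : z < y) : z ∈ interior K :=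
  interior_mono ((Set.Ioo_subset_Icc_self).trans (hK.ordConnected.out hx hy))
    (by rw [interior_Ioo]; exact ⟨hxz, hzy⟩)

/-- Rolle's theorem for finitely many zeros in a convex set: the derivative has at least one zero
less, all of them new and in the interior. -/
lemma exists_derivative_zeros_interior {f : ℝ[X]} (hf : derivative f ≠ 0) {K : Set ℝ}
    (hK : Convex ℝ K) (Z : Finset ℝ) (hZK : ∀ x ∈ Z, x ∈ K) (hZ : ∀ x ∈ Z, f.eval x = 0) :
    ∃ W : Finset ℝ, (∀ x ∈ W, x ∈ interior K ∧ (derivative f).eval x = 0 ∧ x ∉ Z) ∧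
      Z.card ≤ W.card + 1 := by
  classical
  refine ⟨(derivative f).roots.toFinset.filter (· ∈ interior K) \ Z, fun x hx => ?_,
    Finset.card_le_sdiff_of_interleaved fun x hx y hy hxy _ => ?_⟩
  · simp only [Finset.mem_sdiff, Finset.mem_filter, Multiset.mem_toFinset, mem_roots hf,
      IsRoot.def] at hx
    exact ⟨hx.1.2, hx.1.1, hx.2⟩
  · obtain ⟨z, hz, hz0⟩ := exists_deriv_eq_zero hxy f.continuousOn ((hZ x hx).trans (hZ y hy).symm)
    refine ⟨z, ?_, hz⟩
    simp only [Finset.mem_filter, Multiset.mem_toFinset, mem_roots hf, IsRoot.def]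
    exact ⟨by rwa [← f.deriv], mem_interior_of_lt_of_lt hK (hZK x hx) (hZK y hy) hz.1 hz.2⟩

/-- Fewer than `d + 1` homogeneous Birkhoff conditions of order at most `d` have a nonzero solution
of degree at most `d`; conditions of higher order hold automatically. -/
lemma exists_birkhoff_solution (C : ℕ → Finset ℝ) (d : ℕ)
    (h : ∑ i ∈ Finset.range (d + 1), (C i).card < d + 1) :
    ∃ f : ℝ[X], f ≠ 0 ∧ f.natDegree ≤ d ∧ ∀ k, ∀ x ∈ C k, (derivative^[k] f).eval x = 0 := by
  let E : Finset (Σ _ : ℕ, ℝ) := (Finset.range (d + 1)).sigma C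
  let L : degreeLT ℝ (d + 1) →ₗ[ℝ] (E → ℝ) := LinearMap.pi fun e =>
    (leval e.1.2 ∘ₗ (derivative ^ e.1.1)) ∘ₗ (degreeLT ℝ (d + 1)).subtype
  have : Module.Finite ℝ (degreeLT ℝ (d + 1)) :=
    Module.Finite.equiv (degreeLTEquiv ℝ (d + 1)).symm
  have hL : LinearMap.ker L ≠ ⊥ := by
    apply L.ker_ne_bot_of_finrank_lt
    rw [(degreeLTEquiv ℝ (d + 1)).finrank_eq]
    simpa [E] using h
  obtain ⟨⟨f, hfd⟩, hf, hf0⟩ := (Submodule.ne_bot_iff _).mp hL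
  have hf0' : f ≠ 0 := fun h0 => hf0 (by simp [h0])
  have hdeg : f.natDegree ≤ d := by
    rw [mem_degreeLT, degree_eq_natDegree hf0'] at hfd
    exact Nat.lt_succ_iff.mp (by exact_mod_cast hfd)
  refine ⟨f, hf0', hdeg, fun k x hx => ?_⟩
  rcases le_or_gt k d with hk | hk
  · have := congrFun (LinearMap.mem_ker.mp hf)
      ⟨⟨k, x⟩, Finset.mem_sigma.mpr ⟨Finset.mem_range.mpr (Nat.lt_succ_of_le hk), hx⟩⟩
    simpa [L, Module.End.pow_apply] using this
  · rw [iterate_derivative_eq_zero (hdeg.trans_lt hk), eval_zero]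

/-- Sequentially ordered homogeneous Birkhoff conditions have a nonzero solution whose degree is at
most the number of conditions, which has no further zeros in the first convex set and only simple
zeros in its interior. -/
lemma exists_sequentially_ordered_birkhoff_solution (C : ℕ → Finset ℝ) (K : ℕ → Set ℝ)
    (hK : ∀ k, Convex ℝ (K k)) (hCK : ∀ k, ∀ x ∈ C k, x ∈ K k)
    (hmono : ∀ k, interior (K k) ⊆ K (k + 1))
    (hdisj : ∀ k, ∀ x ∈ C (k + 1), x ∉ interior (K k))
    (B : ℕ) (hB : ∀ d, ∑ i ∈ Finset.range d, (C i).card ≤ B) :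
    ∃ Q : ℝ[X], Q ≠ 0 ∧ Q.natDegree ≤ B ∧ (∀ k, ∀ x ∈ C k, (derivative^[k] Q).eval x = 0) ∧
      (∀ x ∈ K 0, Q.eval x = 0 → x ∈ C 0) ∧
      ∀ x ∈ interior (K 0), Q.eval x = 0 → (derivative Q).eval x ≠ 0 := by
  classical
  have hex : ∃ d, ∃ f : ℝ[X], f ≠ 0 ∧ f.natDegree ≤ d ∧
      ∀ k, ∀ x ∈ C k, (derivative^[k] f).eval x = 0 :=
    ⟨B, exists_birkhoff_solution C B (Nat.lt_succ_of_le (hB _))⟩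
  let d := Nat.find hex
  have hdB : d ≤ B := Nat.find_min' hex (exists_birkhoff_solution C B (Nat.lt_succ_of_le (hB _)))
  have hmin : ∀ e < d, ¬ ∃ f : ℝ[X], f ≠ 0 ∧ f.natDegree ≤ e ∧
      ∀ k, ∀ x ∈ C k, (derivative^[k] f).eval x = 0 := fun e he => Nat.find_min hex he
  obtain ⟨Q, hQ0, hQd, hQ⟩ : ∃ f : ℝ[X], f ≠ 0 ∧ f.natDegree ≤ d ∧
      ∀ k, ∀ x ∈ C k, (derivative^[k] f).eval x = 0 := Nat.find_spec hex
  have hQd' : Q.natDegree = d :=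
    hQd.antisymm (not_lt.mp fun hlt => hmin _ hlt ⟨Q, hQ0, le_rfl, hQ⟩)
  have hcount : d ≤ ∑ i ∈ Finset.range d, (C i).card := by
    rcases Nat.eq_zero_or_pos d with h0 | hpos
    · omega
    · by_contra! hlt
      refine hmin (d - 1) (by omega) (exists_birkhoff_solution C (d - 1) ?_)
      rwa [Nat.sub_add_cancel hpos]
  have htop : ∀ x, (derivative^[d] Q).eval x ≠ 0 := by
    intro x
    have hdeg : (derivative^[d] Q).natDegree ≤ 0 := by
      simpa [hQd'] using Q.natDegree_iterate_derivative d
    rw [eq_C_of_natDegree_le_zero hdeg, eval_C, coeff_iterate_derivative, zero_add,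
      Nat.descFactorial_self, nsmul_eq_mul, ← hQd']
    exact mul_ne_zero (by positivity) (leadingCoeff_ne_zero.mpr hQ0)
  have hne : ∀ k ≤ d, derivative^[k] Q ≠ 0 := by
    intro k hk h0
    refine htop 0 ?_
    rw [← Nat.sub_add_cancel hk, Function.iterate_add_apply, h0, iterate_derivative_zero,
      eval_zero]
  -- the conditions up to order `k`, together with one more zero
  let HasExtraZero : ℕ → Prop := fun k => ∃ Z : Finset ℝ,
    (∀ x ∈ Z, x ∈ K k ∧ (derivative^[k] Q).eval x = 0) ∧
    ∑ i ∈ Finset.range (k + 1), (C i).card + 1 ≤ Z.card + k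
  have hstep : ∀ k, k + 1 ≤ d → HasExtraZero k → HasExtraZero (k + 1) := by
    rintro k hk ⟨Z, hZ, hZc⟩
    obtain ⟨W, hW, hWc⟩ := exists_derivative_zeros_interior
      (f := derivative^[k] Q) (by rw [← Function.iterate_succ_apply' derivative]; exact hne _ hk)
      (hK k) Z (fun x hx => (hZ x hx).1) (fun x hx => (hZ x hx).2)
    refine ⟨W ∪ C (k + 1), fun x hx => ?_, ?_⟩
    · rcases Finset.mem_union.mp hx with hx | hx
      · exact ⟨hmono k (hW x hx).1, by rw [Function.iterate_succ_apply']; exact (hW x hx).2.1⟩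
      · exact ⟨hCK _ x hx, hQ _ x hx⟩
    · rw [Finset.card_union_of_disjoint, Finset.sum_range_succ]
      · omega
      · exact Finset.disjoint_left.mpr fun x hx hx' => hdisj k x hx' (hW x hx).1
  have hno : ∀ k ≤ d, ¬ HasExtraZero k := by
    intro k hk h
    obtain ⟨Z, hZ, hZc⟩ := Nat.decreasingInduction' (P := fun j => HasExtraZero j → HasExtraZero d)
      (fun j hj _ ih hj' => ih (hstep j hj hj')) hk id h
    have hZ0 : Z = ∅ := Finset.eq_empty_of_forall_notMem fun x hx => htop x (hZ x hx).2
    rw [Finset.sum_range_succ, hZ0, Finset.card_empty] at hZc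
    omega
  have hzero : ∀ x ∈ K 0, Q.eval x = 0 → x ∈ C 0 := by
    intro x hx hx0
    by_contra hxC
    refine hno 0 (Nat.zero_le _) ⟨insert x (C 0), fun y hy => ?_, ?_⟩
    · rcases Finset.mem_insert.mp hy with rfl | hy
      exacts [⟨hx, hx0⟩, ⟨hCK 0 y hy, hQ 0 y hy⟩]
    · rw [Finset.card_insert_of_notMem hxC]
      simp
  refine ⟨Q, hQ0, hQd.trans hdB, hQ, hzero, fun x hx hx0 hx1 => ?_⟩
  have hd : 1 ≤ d := Nat.one_le_iff_ne_zero.mpr fun h0 => htop x (by rwa [h0])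
  have hxC : x ∈ C 0 := hzero x (interior_subset hx) hx0
  obtain ⟨W, hW, hWc⟩ := exists_derivative_zeros_interior (f := Q) (hne 1 hd) (hK 0) (C 0)
    (hCK 0) (hQ 0)
  refine hno 1 hd ⟨insert x W ∪ C 1, fun y hy => ?_, ?_⟩
  · rcases Finset.mem_union.mp hy with hy | hy
    · rcases Finset.mem_insert.mp hy with rfl | hy
      exacts [⟨hmono 0 hx, hx1⟩, ⟨hmono 0 (hW y hy).1, (hW y hy).2.1⟩]
    · exact ⟨hCK 1 y hy, hQ 1 y hy⟩
  · rw [Finset.card_union_of_disjoint,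
      Finset.card_insert_of_notMem fun h => (hW x h).2.2 hxC, Finset.sum_range_succ,
      Finset.sum_range_one]
    · omega
    · refine Finset.disjoint_left.mpr fun y hy hy' => hdisj 0 y hy' ?_
      rcases Finset.mem_insert.mp hy with rfl | hy
      exacts [hx, (hW y hy).1]

open Filter Topology in
/-- Near a point, a nonzero polynomial is a power of `x - a` times a factor of constant sign. -/
lemma exists_eval_eq_pow_mul_pos_or_neg {F : ℝ[X]} (hF : F ≠ 0) (a : ℝ) :
    ∃ H : ℝ[X], (∀ x, F.eval x = (x - a) ^ F.rootMultiplicity a * H.eval x) ∧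
      ((∀ᶠ x in 𝓝 a, 0 < H.eval x) ∨ ∀ᶠ x in 𝓝 a, H.eval x < 0) := by
  obtain ⟨H, hFH, hH⟩ := exists_eq_pow_rootMultiplicity_mul_and_not_dvd F hF a
  rw [dvd_iff_isRoot, IsRoot.def] at hH
  refine ⟨H, fun x => ?_, ?_⟩
  · conv_lhs => rw [hFH]
    simp
  · rcases lt_or_gt_of_ne hH with h | h
    · exact Or.inr (H.continuous.continuousAt.eventually_lt_const h)
    · exact Or.inl (H.continuous.continuousAt.eventually_const_lt h)

open Filter Topology in
lemma eventually_nonneg_or_nonpos_of_even_rootMultiplicity {F : ℝ[X]} (hF : F ≠ 0) {a : ℝ}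
    (ha : Even (F.rootMultiplicity a)) :
    (∀ᶠ x in 𝓝 a, 0 ≤ F.eval x) ∨ ∀ᶠ x in 𝓝 a, F.eval x ≤ 0 := by
  obtain ⟨H, hFH, h⟩ := exists_eval_eq_pow_mul_pos_or_neg hF a
  refine h.imp (fun h => h.mono fun x hx => ?_) fun h => h.mono fun x hx => ?_
  · rw [hFH]
    exact mul_nonneg (ha.pow_nonneg _) hx.le
  · rw [hFH]
    exact mul_nonpos_of_nonneg_of_nonpos (ha.pow_nonneg _) hx.le

lemma signChangeAt_of_odd_rootMultiplicity {F : ℝ[X]} (hF : F ≠ 0) {a : ℝ}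
    (ha : Odd (F.rootMultiplicity a)) : SignChangeAt F a := by
  obtain ⟨H, hFH, h⟩ := exists_eval_eq_pow_mul_pos_or_neg hF a
  intro ε hε
  have near : ∀ {r : ℝ → Prop}, (∀ᶠ x in nhds a, r x) →
      ∃ δ > 0, δ < ε ∧ r (a - δ) ∧ r (a + δ) := by
    intro r hr
    obtain ⟨η, hη, hb⟩ := Metric.eventually_nhds_iff.mp hr
    refine ⟨min ε η / 2, by positivity, by linarith [min_le_left ε η, lt_min hε hη],
      hb ?_, hb ?_⟩ <;>
    · rw [Real.dist_eq]
      simp only [sub_sub_cancel_left, abs_neg, add_sub_cancel_left]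
      rw [abs_of_pos (by positivity)]
      linarith [min_le_right ε η, lt_min hε hη]
  have hleft : ∀ δ > 0, (a - δ - a) ^ F.rootMultiplicity a < 0 := fun δ hδ =>
    ha.pow_neg (by linarith)
  have hright : ∀ δ > 0, 0 < (a + δ - a) ^ F.rootMultiplicity a := fun δ hδ =>
    pow_pos (by linarith) _
  have habs : ∀ δ > 0, δ < ε → |a - δ - a| < ε ∧ |a + δ - a| < ε := fun δ hδ hδε => by
    simpa [abs_of_pos hδ] using hδε
  rcases h with h | h <;> obtain ⟨δ, hδ, hδε, h₁, h₂⟩ := near h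
  · refine ⟨⟨a - δ, (habs δ hδ hδε).1, ?_⟩, ⟨a + δ, (habs δ hδ hδε).2, ?_⟩⟩ <;> rw [hFH]
    · exact mul_neg_of_neg_of_pos (hleft δ hδ) h₁
    · exact mul_pos (hright δ hδ) h₂
  · refine ⟨⟨a + δ, (habs δ hδ hδε).2, ?_⟩, ⟨a - δ, (habs δ hδ hδε).1, ?_⟩⟩ <;> rw [hFH]
    · exact mul_neg_of_pos_of_neg (hright δ hδ) h₂
    · exact mul_pos_of_neg_of_neg (hleft δ hδ) h₁

open Filter Topology in
lemma nonneg_or_nonpos_of_even_rootMultiplicity {F : ℝ[X]} (hF : F ≠ 0) {U : Set ℝ}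
    (hU : IsPreconnected U) (h : ∀ x ∈ U, Even (F.rootMultiplicity x)) :
    (∀ x ∈ U, 0 ≤ F.eval x) ∨ ∀ x ∈ U, F.eval x ≤ 0 := by
  have hdisj : Disjoint {a : ℝ | ∀ᶠ x in 𝓝 a, 0 ≤ F.eval x} {a | ∀ᶠ x in 𝓝 a, F.eval x ≤ 0} := by
    refine Set.disjoint_left.mpr fun a ha ha' => ?_
    obtain ⟨s, hs, hso, has⟩ := eventually_nhds_iff.mp (ha.and ha')
    refine (infinite_of_mem_nhds a (hso.mem_nhds has)).mono (fun x hx => ?_)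
      (F.rootSet_finite ℝ)
    rw [mem_rootSet_of_ne hF]
    simpa using le_antisymm (hs x hx).2 (hs x hx).1
  refine (hU.subset_or_subset isOpen_setOfPred_eventually_nhds isOpen_setOfPred_eventually_nhds hdisj
    fun x hx => eventually_nonneg_or_nonpos_of_even_rootMultiplicity hF (h x hx)).imp ?_ ?_ <;>
  exact fun hs x hx => (hs hx).self_of_nhds

/-- The first variation of the `L^p` norm along polynomials. -/
lemma hasDerivAt_integral_abs_eval_sub_rpow {p : ℝ} (hp : 1 < p) {ν : Measure ℝ}
    (hint : ∀ q : ℝ[X], Integrable (fun x => |q.eval x| ^ p) ν) (P Q : ℝ[X]) :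
    Integrable (fun x => p * |P.eval x| ^ (p - 2) * P.eval x * (-Q.eval x)) ν ∧
    HasDerivAt (fun t : ℝ => ∫ x, |P.eval x - t * Q.eval x| ^ p ∂ν)
      (∫ x, p * |P.eval x| ^ (p - 2) * P.eval x * (-Q.eval x) ∂ν) 0 := by
  have key := hasDerivAt_integral_of_dominated_loc_of_deriv_le (μ := ν) (x₀ := (0 : ℝ))
    (s := Metric.ball 0 1) (F := fun t x => |P.eval x - t * Q.eval x| ^ p)
    (F' := fun t x => p * |P.eval x - t * Q.eval x| ^ (p - 2) * (P.eval x - t * Q.eval x) *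
      (-Q.eval x))
    (bound := fun x => p * |(1 + P ^ 2 + Q ^ 2).eval x| ^ p)
    (Metric.ball_mem_nhds _ one_pos) ?_ ?_ ?_ ?_ ((hint _).const_mul p) ?_
  · simpa using key
  · refine Filter.Eventually.of_forall fun t => Measurable.aestronglyMeasurable ?_
    have : Measurable fun x => P.eval x - t * Q.eval x := by fun_prop
    exact this.abs.pow_const p
  · simpa using hint P
  · refine Measurable.aestronglyMeasurable ?_
    have h₁ : Measurable fun x => P.eval x - 0 * Q.eval x := by fun_prop
    exact (((h₁.abs.pow_const _).const_mul p).mul h₁).mul Q.continuous.measurable.neg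
  · refine Filter.Eventually.of_forall fun x t ht => ?_
    set u := P.eval x - t * Q.eval x with hu
    have ht' : |t| ≤ 1 := by simpa using (mem_ball_zero_iff.mp ht).le
    have hb : |(1 + P ^ 2 + Q ^ 2).eval x| = 1 + P.eval x ^ 2 + Q.eval x ^ 2 := by
      rw [abs_of_nonneg] <;> simp only [eval_add, eval_one, eval_pow]; positivity
    set b := 1 + P.eval x ^ 2 + Q.eval x ^ 2 with hbdef
    have hQb : |Q.eval x| ≤ b := by
      nlinarith [sq_abs (Q.eval x), sq_nonneg (|Q.eval x| - 1), sq_nonneg (P.eval x)]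
    have hub : |u| ≤ b := by
      have : |u| ≤ |P.eval x| + |Q.eval x| := by
        refine (abs_sub _ _).trans ?_
        rw [abs_mul]
        gcongr
        exact mul_le_of_le_one_left (abs_nonneg _) ht'
      nlinarith [sq_abs (Q.eval x), sq_abs (P.eval x), sq_nonneg (|Q.eval x| - 1),
        sq_nonneg (|P.eval x| - 1)]
    have hb0 : 0 < b := by positivity
    have hpow : |u| ^ (p - 2) * |u| = |u| ^ (p - 1) := by
      rcases eq_or_ne u 0 with h0 | h0
      · simp [h0, Real.zero_rpow (by linarith : p - 1 ≠ 0)]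
      · rw [← Real.rpow_add_one (abs_ne_zero.mpr h0)]
        congr 1
        ring
    rw [hb]
    calc ‖p * |u| ^ (p - 2) * u * -Q.eval x‖
        = p * |u| ^ (p - 1) * |Q.eval x| := by
          rw [norm_mul, norm_mul, norm_mul, norm_neg, Real.norm_eq_abs, Real.norm_eq_abs,
            Real.norm_eq_abs, Real.norm_eq_abs, abs_of_pos (by linarith : 0 < p),
            abs_of_nonneg (by positivity : 0 ≤ |u| ^ (p - 2)), mul_assoc p, hpow]
      _ ≤ p * b ^ (p - 1) * b := by
          have : 0 ≤ p := by linarith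
          gcongr
      _ = p * b ^ p := by
          rw [mul_assoc, ← Real.rpow_add_one hb0.ne', sub_add_cancel]
  · refine Filter.Eventually.of_forall fun x t _ => ?_
    have h₁ : HasDerivAt (fun t : ℝ => P.eval x - t * Q.eval x) (-Q.eval x) t := by
      simpa using ((hasDerivAt_id t).mul_const (Q.eval x)).const_sub (P.eval x)
    exact (hasDerivAt_abs_rpow _ hp).comp t h₁

lemma measSupport_eq_support (μ : Measure ℝ) : measSupport μ = μ.support := by
  rw [Measure.support_eq_forall_isOpen]
  ext x
  simp only [measSupport, Set.mem_ofPred_eq, pos_iff_ne_zero]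
  exact forall_congr' fun U => ⟨fun h hx hU => h hU hx, fun h hU hx => h hx hU⟩

/-- If `P * Q` does not change sign on a conull convex set, the first variation of the `L^p` norm
of `P` along `Q` does not vanish. -/
lemma integral_abs_rpow_mul_ne_zero {p : ℝ} (hp : 1 < p) {μ : Measure ℝ} {Δ : Set ℝ}
    (hΔm : MeasurableSet Δ) (hΔc : μ Δᶜ = 0) (hinf : (measSupport μ).Infinite) {P Q : ℝ[X]}
    (hPQ0 : P * Q ≠ 0)
    (hint : Integrable (fun x => p * |P.eval x| ^ (p - 2) * P.eval x * (-Q.eval x))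
      (μ.restrict Δ))
    (hsign : (∀ x ∈ Δ, 0 ≤ (P * Q).eval x) ∨ ∀ x ∈ Δ, (P * Q).eval x ≤ 0) :
    ∫ x in Δ, p * |P.eval x| ^ (p - 2) * P.eval x * (-Q.eval x) ∂μ ≠ 0 := by
  intro h0
  have hform : ∀ x, p * |P.eval x| ^ (p - 2) * P.eval x * (-Q.eval x) =
      -(p * |P.eval x| ^ (p - 2) * (P * Q).eval x) := fun x => by rw [eval_mul]; ring
  have hp0 : 0 < p := one_pos.trans hp
  have hzero : (fun x => p * |P.eval x| ^ (p - 2) * P.eval x * (-Q.eval x))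
      =ᵐ[μ.restrict Δ] 0 := by
    rcases hsign with h | h
    · have hneg : (fun x => -(p * |P.eval x| ^ (p - 2) * P.eval x * (-Q.eval x)))
          =ᵐ[μ.restrict Δ] 0 := by
        refine (integral_eq_zero_iff_of_nonneg_ae ?_ hint.fun_neg).mp
          (by rw [integral_neg, h0, neg_zero])
        refine (ae_restrict_mem hΔm).mono fun x hx => ?_
        have := h x hx
        simp only [hform, neg_neg, Pi.zero_apply]
        positivity
      exact hneg.mono fun x hx => neg_eq_zero.mp hx
    · refine (integral_eq_zero_iff_of_nonneg_ae ?_ hint).mp h0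
      refine (ae_restrict_mem hΔm).mono fun x hx => ?_
      simp only [hform, Pi.zero_apply]
      exact neg_nonneg.mpr (mul_nonpos_of_nonneg_of_nonpos (by positivity) (h x hx))
  have hnull : μ {x | (P * Q).eval x ≠ 0} = 0 := by
    have hae : ∀ᵐ x ∂μ, x ∈ Δ → (P * Q).eval x = 0 := by
      rw [← ae_restrict_iff' hΔm]
      refine hzero.mono fun x hx => ?_
      beta_reduce at hx
      rw [Pi.zero_apply, hform, neg_eq_zero, mul_eq_zero, mul_eq_zero] at hx
      rcases hx with (hx | hx) | hx
      · exact absurd hx hp0.ne'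
      · rw [Real.rpow_eq_zero_iff_of_nonneg (abs_nonneg _), abs_eq_zero] at hx
        rw [eval_mul, hx.1, zero_mul]
      · exact hx
    have hΔ : ∀ᵐ x ∂μ, x ∈ Δ := mem_ae_iff.mpr hΔc
    exact ae_iff.mp (hae.mp (hΔ.mono fun x hx h => h hx))
  refine hinf (((P * Q).rootSet_finite ℝ).subset fun x hx => ?_)
  rw [mem_rootSet_of_ne hPQ0, coe_aeval_eq_eval]
  by_contra hne
  exact hx _ (isOpen_ne_fun (P * Q).continuous continuous_const) hne hnull

open scoped Classical in
/-- Zero count for sequentially-ordered discrete Sobolev norms (`1 < p < ∞`):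
the `n`-th minimal monic polynomial has at least `n - d*` sign changes in the
interior of `Δ`, where `d*` is the number of pairs `(j,k)` with `A_{j,k} > 0`. -/
theorem sign_changes_sequentially_ordered_sobolev
    (p : ℝ) (hp : 1 < p) (μ : Measure ℝ) (hfin : IsFiniteMeasure μ)
    (hint : ∀ q : Polynomial ℝ, Integrable (fun x => |q.eval x| ^ p) μ)
    (Δ : Set ℝ) (hΔ : Δ = convexHull ℝ (measSupport μ))
    (hΔinf : (measSupport μ).Infinite)
    (N : ℕ) (c : Fin N → ℝ) (hc : ∀ j, c j ∉ interior Δ)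
    (m : ℕ) (A : Fin N → ℕ → ℝ) (hA : ∀ j k, 0 ≤ A j k)
    (hAm : ∀ (j : Fin N) (k : ℕ), m < k → A j k = 0)
    (D : ℕ → Set ℝ)
    (hD0 : D 0 = convexHull ℝ (Δ ∪ {x : ℝ | ∃ j : Fin N, 0 < A j 0 ∧ x = c j}))
    (hDk : ∀ k, 1 ≤ k → D k = convexHull ℝ {x : ℝ | ∃ j : Fin N, 0 < A j k ∧ x = c j})
    (horder : ∀ k, 1 ≤ k → k ≤ m →
      D k ∩ interior (convexHull ℝ (⋃ i < k, D i)) = ∅)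
    (dstar : ℕ)
    (hdstar : dstar = ((Finset.univ ×ˢ Finset.range (m + 1)).filter
      (fun q : Fin N × ℕ => 0 < A q.1 q.2)).card)
    (sob : Polynomial ℝ → ℝ)
    (hsob : ∀ f : Polynomial ℝ,
      sob f = ((∫ x in Δ, |f.eval x| ^ p ∂ μ) +
        ∑ j : Fin N, ∑ k ∈ Finset.range (m + 1),
          A j k * |(derivative^[k] f).eval (c j)| ^ p) ^ (1 / p))
    (n : ℕ) (P : Polynomial ℝ) (hPm : P.Monic) (hPd : P.natDegree = n)
    (hmin : ∀ Q : Polynomial ℝ, Q.Monic → Q.natDegree = n → sob P ≤ sob Q) :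
    ∃ S : Finset ℝ, ↑S ⊆ interior Δ ∧ n - dstar ≤ S.card ∧
      ∀ ξ ∈ S, SignChangeAt P ξ := by
  have hp0 : 0 < p := one_pos.trans hp
  have hP0 : P ≠ 0 := hPm.ne_zero
  have hΔconv : Convex ℝ Δ := hΔ ▸ convex_convexHull ℝ _
  have hΔm : MeasurableSet Δ := hΔconv.ordConnected.measurableSet
  have hsuppΔ : measSupport μ ⊆ Δ := hΔ ▸ subset_convexHull ℝ _
  have hΔc : μ Δᶜ = 0 := by
    refine measure_mono_null (Set.compl_subset_compl.mpr hsuppΔ) ?_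
    rw [measSupport_eq_support]
    exact Measure.measure_compl_support
  have hΔint : (interior Δ).Nonempty := by
    obtain ⟨x, hx, y, hy, hxy⟩ := (hΔinf.mono hsuppΔ).nontrivial.exists_lt
    obtain ⟨z, hxz, hzy⟩ := exists_between hxy
    exact ⟨z, mem_interior_of_lt_of_lt hΔconv hx hy hxz hzy⟩
  let S : Finset ℝ := P.roots.toFinset.filter
    fun x => x ∈ interior Δ ∧ Odd (P.rootMultiplicity x)
  have hS : ∀ x, x ∈ S ↔ x ∈ interior Δ ∧ Odd (P.rootMultiplicity x) := fun x => by
    simp only [S, Finset.mem_filter, Multiset.mem_toFinset, and_iff_right_iff_imp]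
    rintro ⟨-, h⟩
    exact (mem_roots hP0).mpr ((rootMultiplicity_pos hP0).mp h.pos)
  refine ⟨S, fun x hx => ((hS x).mp hx).1, ?_,
    fun ξ hξ => signChangeAt_of_odd_rootMultiplicity hP0 ((hS ξ).mp hξ).2⟩
  by_contra! hlt
  let M : ℕ → Finset ℝ := fun k => (Finset.univ.filter fun j => 0 < A j k).image c
  let C : ℕ → Finset ℝ := fun k => if k = 0 then S ∪ M 0 else M k
  let K : ℕ → Set ℝ := fun k => convexHull ℝ (⋃ i < k + 1, D i)
  have hDK : ∀ k, D k ⊆ K k := fun k => (Set.subset_biUnion_of_mem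
    (u := D) (show k ∈ {i | i < k + 1} from Nat.lt_succ_self k)).trans (subset_convexHull ℝ _)
  have hmemM : ∀ k x, x ∈ M k ↔ ∃ j, 0 < A j k ∧ c j = x := fun k x => by simp [M]
  have hMD : ∀ k, ∀ x ∈ M k, x ∈ D k := by
    intro k x hx
    obtain ⟨j, hj, rfl⟩ := (hmemM k x).mp hx
    rcases Nat.eq_zero_or_pos k with rfl | hk
    · rw [hD0]
      exact subset_convexHull ℝ _ (Or.inr ⟨j, hj, rfl⟩)
    · rw [hDk k hk]
      exact subset_convexHull ℝ _ ⟨j, hj, rfl⟩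
  have hΔK : Δ ⊆ K 0 := by
    refine Set.Subset.trans ?_ (hDK 0)
    rw [hD0]
    exact Set.subset_union_left.trans (subset_convexHull ℝ _)
  have hMcard : ∀ d, ∑ i ∈ Finset.range d, (M i).card ≤ dstar := by
    intro d
    have hle : ∀ k, (M k).card ≤ (Finset.univ.filter fun j => 0 < A j k).card :=
      fun k => Finset.card_image_le
    have hz : ∀ k, m < k → (M k).card = 0 := fun k hk => by simp [M, hAm _ k hk]
    have hds : dstar = ∑ k ∈ Finset.range (m + 1),
        (Finset.univ.filter fun j => 0 < A j k).card := by
      rw [hdstar, Finset.card_filter, Finset.sum_product_right]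
      simp only [Finset.card_filter]
    calc ∑ i ∈ Finset.range d, (M i).card
        ≤ ∑ i ∈ Finset.range (max d (m + 1)), (M i).card :=
          Finset.sum_le_sum_of_subset (Finset.range_mono (le_max_left _ _))
      _ = ∑ i ∈ Finset.range (m + 1), (M i).card := by
          refine (Finset.sum_subset (Finset.range_mono (le_max_right _ _)) fun k _ hk => ?_).symm
          exact hz k (not_le.mp fun h => hk (Finset.mem_range.mpr (Nat.lt_succ_of_le h)))
      _ ≤ dstar := hds ▸ Finset.sum_le_sum fun k _ => hle k
  obtain ⟨Q, hQ0, hQd, hQ, hQzero, hQsimple⟩ :=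
    exists_sequentially_ordered_birkhoff_solution C K (fun k => convex_convexHull ℝ _)
      (by
        intro k x hx
        rcases Nat.eq_zero_or_pos k with rfl | hk
        · rcases Finset.mem_union.mp (show x ∈ S ∪ M 0 from hx) with hx | hx
          · exact hΔK (interior_subset ((hS x).mp hx).1)
          · exact hDK 0 (hMD 0 x hx)
        · simp only [C, hk.ne', if_false] at hx
          exact hDK k (hMD k x hx))
      (fun k => interior_subset.trans (convexHull_mono
        (Set.biUnion_subset_biUnion_left fun i hi => Nat.lt_succ_of_lt hi)))
      (by
        intro k x hx hxK
        have hx : x ∈ M (k + 1) := hx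
        have hk : k + 1 ≤ m := by
          by_contra! hk
          obtain ⟨j, hj, -⟩ := (hmemM _ x).mp hx
          exact hj.ne' (hAm j _ hk)
        have : x ∈ D (k + 1) ∩ interior (convexHull ℝ (⋃ i < k + 1, D i)) :=
          ⟨hMD _ x hx, hxK⟩
        rw [horder _ (Nat.le_add_left 1 k) hk] at this
        exact this)
      (S.card + dstar)
      (by
        intro d
        rcases d with _ | d
        · simp
        · have h1 := hMcard (d + 1)
          have h2 : (C 0).card ≤ S.card + (M 0).card := Finset.card_union_le S (M 0)
          rw [Finset.sum_range_succ'] at h1 ⊢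
          have h3 : ∑ i ∈ Finset.range d, (C (i + 1)).card =
            ∑ i ∈ Finset.range d, (M (i + 1)).card := rfl
          omega)
  have hQn : Q.natDegree < n := by omega
  have hPQ0 : P * Q ≠ 0 := mul_ne_zero hP0 hQ0
  have hQS : ∀ x ∈ interior Δ, Q.eval x = 0 ↔ x ∈ S := by
    intro x hx
    refine ⟨fun h => ?_, fun h => hQ 0 x (Finset.mem_union_left _ h)⟩
    rcases Finset.mem_union.mp (show x ∈ S ∪ M 0 from hQzero x (hΔK (interior_subset hx)) h)
      with h' | h'
    · exact h'
    · obtain ⟨j, -, rfl⟩ := (hmemM 0 x).mp h'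
      exact absurd hx (hc j)
  have heven : ∀ x ∈ interior Δ, Even ((P * Q).rootMultiplicity x) := by
    intro x hx
    rw [rootMultiplicity_mul hPQ0]
    by_cases hxS : x ∈ S
    · have hx0 := (hQS x hx).mpr hxS
      have h1 : Q.rootMultiplicity x = 1 := by
        refine le_antisymm (not_lt.mp fun h => ?_) ((rootMultiplicity_pos hQ0).mpr hx0)
        exact hQsimple x (interior_mono hΔK hx) hx0
          ((one_lt_rootMultiplicity_iff_isRoot hQ0).mp h).2
      rw [h1]
      exact ((hS x).mp hxS).2.add_one
    · rw [rootMultiplicity_eq_zero fun h => hxS ((hQS x hx).mp h), add_zero]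
      exact Nat.not_odd_iff_even.mp fun h => hxS ((hS x).mpr ⟨hx, h⟩)
  have hΔcl : Δ ⊆ closure (interior Δ) := by
    rw [hΔconv.closure_interior_eq_closure_of_nonempty_interior hΔint]
    exact subset_closure
  have hsign : (∀ x ∈ Δ, 0 ≤ (P * Q).eval x) ∨ ∀ x ∈ Δ, (P * Q).eval x ≤ 0 :=
    (nonneg_or_nonpos_of_even_rootMultiplicity hPQ0 hΔconv.interior.isPreconnected heven).imp
      (fun h x hx => closure_minimal h (isClosed_le continuous_const (P * Q).continuous) (hΔcl hx))
      (fun h x hx => closure_minimal h (isClosed_le (P * Q).continuous continuous_const) (hΔcl hx))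
  have hmin' : ∀ t : ℝ, ∫ x in Δ, |P.eval x| ^ p ∂μ ≤
      ∫ x in Δ, |P.eval x - t * Q.eval x| ^ p ∂μ := by
    intro t
    have hdeg : (Polynomial.C t * Q).degree < P.degree := by
      refine degree_lt_degree ((natDegree_C_mul_le t Q).trans_lt ?_)
      rwa [hPd]
    have hle := hmin (P - Polynomial.C t * Q) (hPm.sub_of_left hdeg)
      (by rw [natDegree_sub_eq_left_of_natDegree_lt (by
        rw [hPd]; exact (natDegree_C_mul_le t Q).trans_lt hQn), hPd])
    have hsum0 : ∀ f : ℝ[X], 0 ≤ ∑ j : Fin N, ∑ k ∈ Finset.range (m + 1),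
        A j k * |(derivative^[k] f).eval (c j)| ^ p := fun f =>
      Finset.sum_nonneg fun j _ => Finset.sum_nonneg fun k _ =>
        mul_nonneg (hA j k) (by positivity)
    have hint0 : ∀ f : ℝ[X], 0 ≤ ∫ x in Δ, |f.eval x| ^ p ∂μ := fun f =>
      integral_nonneg fun x => by positivity
    have hsum : ∀ j : Fin N, ∀ k, A j k *
        |(derivative^[k] (P - Polynomial.C t * Q)).eval (c j)| ^ p =
        A j k * |(derivative^[k] P).eval (c j)| ^ p := by
      intro j k
      rcases (hA j k).eq_or_lt with h | h
      · rw [← h, zero_mul, zero_mul]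
      · have hj : c j ∈ C k := by
          have hj : c j ∈ M k := (hmemM k _).mpr ⟨j, h, rfl⟩
          by_cases hk : k = 0
          · subst hk
            exact Finset.mem_union_right S hj
          · simpa only [C, hk, if_false] using hj
        rw [iterate_derivative_sub, iterate_derivative_C_mul, eval_sub, eval_mul, hQ k _ hj,
          mul_zero, sub_zero]
    rw [hsob, hsob, Real.rpow_le_rpow_iff (add_nonneg (hint0 _) (hsum0 _))
      (add_nonneg (hint0 _) (hsum0 _)) (by positivity)] at hle
    simp only [hsum, eval_sub, eval_mul, eval_C] at hle
    linarith
  obtain ⟨hI, hderiv⟩ := hasDerivAt_integral_abs_eval_sub_rpow hp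
    (fun q => (hint q).mono_measure (Measure.restrict_le_self (s := Δ))) P Q
  refine integral_abs_rpow_mul_ne_zero hp hΔm hΔc hΔinf hPQ0 hI hsign ?_
  refine IsLocalMin.hasDerivAt_eq_zero (Filter.Eventually.of_forall fun t => ?_) hderiv
  simpa using hmin' t
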